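/- Let k ≥ 3 and ℓ ∈ [k−1], and set t = ⌊k/(k−ℓ)⌋·(k−ℓ). There exists μ₀ > 0 such that for every μ ∈ (0, μ₀] there exists ε₀ > 0 such that for every ε ∈ (0, ε₀] there exists n₀ such that the following holds for every n ≥ n₀ divisible by k−ℓ. Let w* = (w_1,…,w_k) with w_1 = k−1 and w_i = t−1 for 2 ≤ i ≤ k. If H is an n-vertex k-graph with no isolated vertices and δ*(H) ≥ (1 − 1/t − ε)·n, such that every set of at least n/t vertices contains at least μn² supported pairs, then H has a w*-weighted perfect fractional matching. -/

import Mathlib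

open Finset

/-- The ordered edges of the `k`-graph with edge set `E`: injective `k`-tuples
of vertices whose image is an edge. -/
def orderedEdges (k : ℕ) {n : ℕ} (E : Finset (Finset (Fin n))) :
    Finset (Fin k → Fin n) :=
  Finset.univ.filter fun e => Function.Injective e ∧ Finset.image e Finset.univ ∈ E

/-- Farkas' lemma for a finite family of vectors with a common positive coordinate sum. -/
theorem exists_nonneg_combination_eq_one {ι κ : Type*} [Fintype ι] [Fintype κ]
    (a : ι → κ → ℝ) (W : ℝ) (hW : 0 < W) (ha : ∀ e, ∑ v, a e v = W)
    (h : ∀ y : κ → ℝ, (∀ e, 0 ≤ ∑ v, a e v * y v) → 0 ≤ ∑ v, y v) :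
    ∃ q : ι → ℝ, (∀ e, 0 ≤ q e) ∧ ∀ v, ∑ e, q e * a e v = 1 := by
  classical
  rcases isEmpty_or_nonempty κ with hκ | hκ
  · exact ⟨0, fun _ => le_rfl, fun v => (hκ.false v).elim⟩
  have hN : (0 : ℝ) < Fintype.card κ := by exact_mod_cast Fintype.card_pos
  set N : ℝ := (Fintype.card κ : ℝ) with hNdef
  let L : (ι → ℝ) →ₗ[ℝ] (κ → ℝ) := Fintype.linearCombination ℝ a
  have hL : ∀ q v, L q v = ∑ e, q e * a e v := fun q v => by
    simp [L, Fintype.linearCombination_apply]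
  have hconv : Convex ℝ (L '' stdSimplex ℝ ι) := (convex_stdSimplex ℝ ι).linear_image L
  have hclosed : IsClosed (L '' stdSimplex ℝ ι) :=
    ((isCompact_stdSimplex ℝ ι).image L.continuous_of_finiteDimensional).isClosed
  by_cases hp : (fun _ : κ => W / N) ∈ L '' stdSimplex ℝ ι
  · obtain ⟨q, hq, hqp⟩ := hp
    refine ⟨fun e => N / W * q e, fun e => mul_nonneg (by positivity) (hq.1 e), fun v => ?_⟩
    have := congrFun hqp v
    rw [hL] at this
    simp_rw [mul_assoc]
    rw [← Finset.mul_sum, this]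
    field_simp
  · exfalso
    obtain ⟨f, u, hfp, hfu⟩ := geometric_hahn_banach_point_closed hconv hclosed hp
    have hf : ∀ x : κ → ℝ, f x = ∑ v, x v * f (Pi.single v 1) := fun x => by
      conv_lhs => rw [pi_eq_sum_univ' x]
      simp [map_sum, Pi.single]
    have h1 := h (fun v => f (Pi.single v 1) - u / W) (fun e => by
      have he := hfu (a e) ⟨Pi.single e 1, single_mem_stdSimplex ℝ e, by
        funext v
        simp [hL, Pi.single_apply]⟩
      rw [hf] at he
      simp_rw [mul_sub]
      rw [Finset.sum_sub_distrib, ← Finset.sum_mul, ha]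
      have : W * (u / W) = u := by field_simp
      linarith)
    rw [hf, ← Finset.mul_sum] at hfp
    rw [Finset.sum_sub_distrib, Finset.sum_const, nsmul_eq_mul, Finset.card_univ, ← hNdef] at h1
    have h2 : W / N * (N * (u / W)) = u := by field_simp
    have h3 := mul_le_mul_of_nonneg_left (sub_nonneg.1 h1) (by positivity : 0 ≤ W / N)
    linarith

theorem exists_card_eq_forall_le {α : Type*} [Fintype α] (y : α → ℝ) (s : ℕ)
    (hs : s ≤ Fintype.card α) :
    ∃ A : Finset α, A.card = s ∧ ∀ a ∈ A, ∀ b ∉ A, y a ≤ y b := by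
  classical
  induction s with
  | zero => exact ⟨∅, by simp⟩
  | succ s ih =>
    obtain ⟨A, hA, hAy⟩ := ih (by omega)
    have hne : Aᶜ.Nonempty := by
      rw [← Finset.card_pos, Finset.card_compl]
      omega
    obtain ⟨c, hc, hmin⟩ := Aᶜ.exists_min_image y hne
    rw [Finset.mem_compl] at hc
    refine ⟨insert c A, by rw [Finset.card_insert_of_notMem hc, hA], fun a ha b hb => ?_⟩
    rw [Finset.mem_insert, not_or] at hb
    rcases Finset.mem_insert.1 ha with rfl | ha
    · exact hmin b (Finset.mem_compl.2 hb.2)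
    · exact hAy a ha b hb.2

theorem card_filter_subset_le {α : Type*} [Fintype α] [DecidableEq α] {k : ℕ} (hk : 0 < k)
    {E : Finset (Finset α)} (hE : ∀ e ∈ E, e.card = k) {S : Finset α} (hS : S.card = k - 1) :
    (E.filter fun e => S ⊆ e).card ≤ (univ.filter fun w => w ∉ S ∧ insert w S ∈ E).card := by
  refine (Finset.card_le_card fun e he => ?_).trans
    (Finset.card_image_le (f := fun w => insert w S))
  obtain ⟨heE, hSe⟩ := Finset.mem_filter.1 he
  obtain ⟨w, hw, rfl⟩ := (Finset.covBy_iff_exists_insert (s := S) (t := e)).1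
    (Finset.covBy_iff_card_sdiff_eq_one.2 ⟨hSe, by
      rw [Finset.card_sdiff_of_subset hSe, hE e heE]; omega⟩)
  exact Finset.mem_image.2 ⟨w, by simp [hw, heE], rfl⟩

/-- If the vertices outside `A` are fewer than the supported co-degree, then every supported set
extends to an edge by vertices of `A`. -/
theorem exists_edge_sdiff_subset {α : Type*} [Fintype α] [DecidableEq α] {k : ℕ} (hk : 0 < k)
    {E : Finset (Finset α)} (hE : ∀ e ∈ E, e.card = k) {A : Finset α}
    (hA : ∀ S : Finset α, S.card = k - 1 → (∃ e ∈ E, S ⊆ e) →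
      Fintype.card α < (E.filter fun e => S ⊆ e).card + A.card)
    (U : Finset α) (hU : ∃ e ∈ E, U ⊆ e) :
    ∃ e ∈ E, U ⊆ e ∧ e \ U ⊆ A := by
  induction hm : k - U.card generalizing U with
  | zero =>
    obtain ⟨e, he, hUe⟩ := hU
    have : U = e := Finset.eq_of_subset_of_card_le hUe (by rw [hE e he]; omega)
    exact ⟨e, he, hUe, by simp [this]⟩
  | succ m ih =>
    obtain ⟨e, he, hUe⟩ := hU
    obtain ⟨S, hUS, hSe, hS⟩ := Finset.exists_subsuperset_card_eq hUe
      (show U.card ≤ k - 1 by omega) (by rw [hE e he]; omega)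
    have h1 := hA S hS ⟨e, he, hSe⟩
    have h2 := card_filter_subset_le hk hE hS
    obtain ⟨w, hw⟩ : ((univ.filter fun w => w ∉ S ∧ insert w S ∈ E) ∩ A).Nonempty := by
      apply Finset.inter_nonempty_of_card_lt_card_add_card (Finset.subset_univ _)
        (Finset.subset_univ _)
      rw [Finset.card_univ]
      omega
    obtain ⟨hwS, hwA⟩ := Finset.mem_inter.1 hw
    obtain ⟨-, hwS, hwE⟩ := Finset.mem_filter.1 hwS
    have hwU : w ∉ U := fun h => hwS (hUS h)
    obtain ⟨e', he', hUe', hA'⟩ := ih (insert w U)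
      ⟨_, hwE, Finset.insert_subset_insert w hUS⟩
      (by rw [Finset.card_insert_of_notMem hwU]; omega)
    refine ⟨e', he', (Finset.subset_insert w U).trans hUe', fun x hx => ?_⟩
    obtain ⟨hxe, hxU⟩ := Finset.mem_sdiff.1 hx
    by_cases hxw : x = w
    · rwa [hxw]
    · exact hA' (by simp [hxe, hxU, hxw])

theorem exists_orderedEdge {k n : ℕ} (hk : 0 < k) {E : Finset (Finset (Fin n))}
    (hE : ∀ e ∈ E, e.card = k) {e : Finset (Fin n)} (he : e ∈ E) {u : Fin n} (hu : u ∈ e) :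
    ∃ o ∈ orderedEdges k E, o ⟨0, hk⟩ = u ∧ Finset.image o Finset.univ = e := by
  let φ := e.equivFinOfCardEq (hE e he)
  let σ : Fin k ≃ e := (Equiv.swap ⟨0, hk⟩ (φ ⟨u, hu⟩)).trans φ.symm
  have himg : Finset.image (fun i => (σ i : Fin n)) Finset.univ = e := by
    ext x
    simp only [Finset.mem_image, Finset.mem_univ, true_and]
    exact ⟨by rintro ⟨i, rfl⟩; exact (σ i).2, fun hx => ⟨σ.symm ⟨x, hx⟩, by simp⟩⟩
  refine ⟨fun i => σ i, ?_, by simp [σ], himg⟩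
  rw [orderedEdges, Finset.mem_filter]
  exact ⟨Finset.mem_univ _, Subtype.val_injective.comp σ.injective, himg.symm ▸ he⟩

theorem sum_weights_mul {k n : ℕ} (hk : 0 < k) (a b : ℝ) (o : Fin k → Fin n)
    (ho : Function.Injective o) (y : Fin n → ℝ) :
    ∑ i : Fin k, (if (i : ℕ) = 0 then a else b) * y (o i) =
      (a - b) * y (o ⟨0, hk⟩) + b * ∑ v ∈ Finset.image o Finset.univ, y v := by
  rw [Finset.sum_image ho.injOn, Finset.mul_sum,
    ← Finset.add_sum_erase _ _ (Finset.mem_univ (⟨0, hk⟩ : Fin k)),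
    ← Finset.add_sum_erase _ (fun i => b * y (o i))
      (Finset.mem_univ (⟨0, hk⟩ : Fin k))]
  have : ∑ i ∈ Finset.univ.erase (⟨0, hk⟩ : Fin k),
      (if (i : ℕ) = 0 then a else b) * y (o i) =
      ∑ i ∈ Finset.univ.erase (⟨0, hk⟩ : Fin k), b * y (o i) := by
    refine Finset.sum_congr rfl fun i hi => ?_
    have : (i : ℕ) ≠ 0 := fun h => Finset.ne_of_mem_erase hi (Fin.ext h)
    simp [this]
  rw [this]
  simp only [if_true]
  ring

/-- More than `b * n` pairs contain one that avoids a given set of size `b`. -/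
theorem exists_disjoint_of_card_mul_lt {α : Type*} [Fintype α] [DecidableEq α]
    {P : Finset (Finset α)} (hP : ∀ p ∈ P, p.card = 2) {B : Finset α}
    (hB : B.card * Fintype.card α < P.card) : ∃ p ∈ P, Disjoint p B := by
  by_contra! hcon
  refine absurd hB (not_lt.2 ?_)
  rw [← Finset.card_univ, ← Finset.card_product]
  refine (Finset.card_le_card fun p hp => ?_).trans
    (Finset.card_image_le (f := fun x : α × α => ({x.1, x.2} : Finset α)))
  obtain ⟨x, hxp, hxB⟩ := Finset.not_disjoint_iff.1 (hcon p hp)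
  obtain ⟨c, d, -, rfl⟩ := Finset.card_eq_two.1 (hP p hp)
  rw [Finset.mem_insert, Finset.mem_singleton] at hxp
  rcases hxp with rfl | rfl
  · exact Finset.mem_image.2 ⟨(x, d), by simp [hxB], rfl⟩
  · exact Finset.mem_image.2 ⟨(x, c), by simp [hxB], Finset.pair_comm _ _⟩

/-- The dual form: a vertex weighting that is nonnegative on every ordered edge has nonnegative
total weight. -/
theorem sum_nonneg_of_edge_nonneg {α : Type*} [Fintype α] [DecidableEq α] {k t : ℕ} (hk : 3 ≤ k)
    (ht : 2 ≤ t) (htk : t ≤ k) {μ ε : ℝ} (hμ : μ ≤ 1) (hε : 0 < ε)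
    (hεμ : ε * (8 * (k : ℝ) ^ 3) ≤ μ) (hn : 1 ≤ ε * Fintype.card α)
    {E : Finset (Finset α)} (hE : ∀ e ∈ E, e.card = k) (hiso : ∀ v, ∃ e ∈ E, v ∈ e)
    (hdeg : ∀ S : Finset α, S.card = k - 1 → (∃ e ∈ E, S ⊆ e) →
      (1 - 1 / (t : ℝ) - ε) * (Fintype.card α : ℝ) ≤ ((E.filter fun e => S ⊆ e).card : ℝ))
    (hpairs : ∀ A : Finset α, (Fintype.card α : ℝ) / (t : ℝ) ≤ (A.card : ℝ) →
      μ * (Fintype.card α : ℝ) ^ 2 ≤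
        (((A.powersetCard 2).filter fun p => ∃ e ∈ E, p ⊆ e).card : ℝ))
    (y : α → ℝ)
    (hy : ∀ e ∈ E, ∀ u ∈ e, 0 ≤ ((k : ℝ) - t) * y u + ((t : ℝ) - 1) * ∑ v ∈ e, y v) :
    0 ≤ ∑ v, y v := by
  by_contra! hneg
  set N : ℝ := (Fintype.card α : ℝ) with hN
  have hNpos : 0 < N := by
    by_contra! h
    nlinarith
  have hkR : (3 : ℝ) ≤ k := by exact_mod_cast hk
  have htR : (2 : ℝ) ≤ t := by exact_mod_cast ht
  have htkR : (t : ℝ) ≤ k := by exact_mod_cast htk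
  set T : ℝ := (t : ℝ)
  set K : ℝ := (k : ℝ) with hK
  have hinv : 1 / T * T = 1 := by field_simp
  have hinvN : N / T * T = N := by field_simp
  -- `ε` is small compared with `k`
  have hK2 : K ≤ K ^ 2 := by nlinarith
  have hK3 : K ^ 2 ≤ K ^ 3 := by nlinarith [sq_nonneg K]
  have hεk : 2 * ε * T * (K * T + 1) ≤ 1 := by
    have h1 : T * (K * T + 1) ≤ K * (K * K + 1) := by gcongr
    have h2 : T * (K * T + 1) ≤ 4 * K ^ 3 := by nlinarith
    nlinarith
  -- the lowest `s` vertices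
  let s : ℕ := ⌊(1 / T + ε) * N⌋₊ + 1
  have hs_gt : (1 / T + ε) * N < s := by
    simpa [s] using Nat.lt_floor_add_one ((1 / T + ε) * N)
  have hs_le : (s : ℝ) ≤ N / T + 2 * ε * N := by
    have := Nat.floor_le (show 0 ≤ (1 / T + ε) * N by positivity)
    have h3 : (1 / T + ε) * N = N / T + ε * N := by ring
    simp only [s, Nat.cast_add, Nat.cast_one]
    linarith
  have hsT : (s : ℝ) * T ≤ N + 2 * ε * T * N := by
    calc (s : ℝ) * T ≤ (N / T + 2 * ε * N) * T := by gcongr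
      _ = _ := by rw [add_mul, hinvN]; ring
  have hεT : 2 * ε * T ≤ 1 := by
    have : 0 ≤ 2 * ε * T * (K * T) := by positivity
    linarith
  have hsN : s ≤ Fintype.card α := by
    have : (s : ℝ) ≤ N := by nlinarith
    exact Nat.cast_le.1 this
  obtain ⟨A, hAs, hAy⟩ := exists_card_eq_forall_le y s hsN
  have hAext : ∀ S : Finset α, S.card = k - 1 → (∃ e ∈ E, S ⊆ e) →
      Fintype.card α < (E.filter fun e => S ⊆ e).card + A.card := fun S hS hSe => by
    have h1 := hdeg S hS hSe
    have : N < ((E.filter fun e => S ⊆ e).card : ℝ) + s := by nlinarith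
    rw [hAs]
    rw [hN] at this
    exact_mod_cast this
  have hAne : A.Nonempty := by
    rw [← Finset.card_pos, hAs]
    exact Nat.succ_pos _
  obtain ⟨a, haA, hamax⟩ := A.exists_max_image y hAne
  obtain ⟨m, -, hmin⟩ := (Finset.univ : Finset α).exists_min_image y ⟨a, Finset.mem_univ a⟩
  have hmin : ∀ v, y m ≤ y v := fun v => hmin v (Finset.mem_univ v)
  set Y := y a with hY
  obtain ⟨M, hM⟩ : ∃ M, M = -y m := ⟨_, rfl⟩
  have hMpos : 0 < M := by
    by_contra! h
    exact absurd hneg (not_lt.2 (Finset.sum_nonneg fun v _ => by linarith [hmin v]))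
  -- edges reaching outside `U` only within `A`
  have hedge : ∀ U : Finset α, (∃ e ∈ E, U ⊆ e) → ∀ u ∈ U,
      0 ≤ (K - T) * y u + (T - 1) * (∑ v ∈ U, y v + (K - U.card) * Y) := fun U hU u hu => by
    obtain ⟨e, he, hUe, heA⟩ := exists_edge_sdiff_subset (by omega) hE hAext U hU
    have h1 := hy e he u (hUe hu)
    have h2 : ∑ v ∈ e \ U, y v ≤ (K - U.card) * Y := by
      have h3 := Finset.sum_le_card_nsmul (e \ U) y Y fun v hv => hamax v (heA hv)
      have h4 := Finset.card_sdiff_add_card_eq_card hUe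
      rw [hE e he] at h4
      have h5 : ((e \ U).card : ℝ) = K - U.card := by
        rw [hK, ← h4]
        push_cast
        ring
      rwa [nsmul_eq_mul, h5] at h3
    have h3 := Finset.sum_sdiff (f := y) hUe
    have h4 : (T - 1) * ∑ v ∈ e, y v ≤ (T - 1) * (∑ v ∈ U, y v + (K - U.card) * Y) :=
      mul_le_mul_of_nonneg_left (by linarith) (by linarith)
    linarith
  have hMY : M ≤ (T - 1) * Y := by
    obtain ⟨e, he, hme⟩ := hiso m
    have h1 := hedge {m} ⟨e, he, by simpa using hme⟩ m (Finset.mem_singleton_self m)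
    rw [Finset.sum_singleton, Finset.card_singleton, Nat.cast_one] at h1
    have h2 : 0 ≤ (K - 1) * ((T - 1) * Y - M) := by rw [hM]; linarith
    have := nonneg_of_mul_nonneg_right h2 (by linarith)
    linarith
  have hsum : ∑ v ∈ A, (y v + M) < s * M - (N - s) * Y := by
    have h1 : (N - s) * Y ≤ ∑ v ∈ Aᶜ, y v := by
      have h2 := Finset.card_nsmul_le_sum Aᶜ y Y fun v hv => hAy a haA v (Finset.mem_compl.1 hv)
      rwa [nsmul_eq_mul, Finset.card_compl, hAs, Nat.cast_sub hsN] at h2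
    have h2 := Finset.sum_add_sum_compl A y
    rw [Finset.sum_add_distrib, Finset.sum_const, nsmul_eq_mul, hAs]
    linarith
  have hnn : ∀ v, 0 ≤ y v + M := fun v => by linarith [hmin v]
  have hYle : (T - 1) * Y * K ≤ M * (K + 1) := by
    have h1 : (N - s) * Y < s * M := by
      have := Finset.sum_nonneg fun v (_ : v ∈ A) => hnn v
      linarith
    have h2 : (N * T - s * T) * ((T - 1) * Y) ≤ s * T * ((T - 1) * M) := by
      have := mul_le_mul_of_nonneg_left h1.le
        (mul_nonneg (by linarith) (by linarith) : 0 ≤ T * (T - 1))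
      linarith
    have h3 : N * (T - 1 - 2 * ε * T) * ((T - 1) * Y) ≤ (N * T - s * T) * ((T - 1) * Y) :=
      mul_le_mul_of_nonneg_right (by linarith) (by linarith)
    have h4 : s * T * ((T - 1) * M) ≤ N * (1 + 2 * ε * T) * ((T - 1) * M) :=
      mul_le_mul_of_nonneg_right (by linarith) (mul_nonneg (by linarith) hMpos.le)
    have h5 : (T - 1 - 2 * ε * T) * ((T - 1) * Y) ≤ (1 + 2 * ε * T) * ((T - 1) * M) :=
      le_of_mul_le_mul_left (by linarith) hNpos
    have h6 : 0 ≤ M * (T - 1 - 2 * ε * T * (K * T + 1)) :=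
      mul_nonneg hMpos.le (by linarith)
    have h7 : 0 < T - 1 - 2 * ε * T := by
      have : 0 < 2 * ε * T * (K * T) := by positivity
      linarith
    refine le_of_mul_le_mul_left ?_ h7
    have := mul_le_mul_of_nonneg_left h5 (by linarith : 0 ≤ K)
    linarith
  have hdef : ∑ v ∈ A, (y v + M) ≤ 4 * ε * N * M := by
    have hT1 : 0 < T - 1 := by linarith
    refine le_of_mul_le_mul_left ?_ hT1
    have h1 := mul_le_mul_of_nonneg_left hsum.le hT1.le
    have h2 : (N - s) * M ≤ (N - s) * ((T - 1) * Y) :=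
      mul_le_mul_of_nonneg_left hMY (sub_nonneg.2 (Nat.cast_le.2 hsN))
    have h3 : s * T * M ≤ (N + 2 * ε * T * N) * M := by gcongr
    have h4 : 0 ≤ ε * N * M * (T - 2) := mul_nonneg (by positivity) (by linarith)
    linarith
  let B := A.filter fun v => M < K * (y v + M)
  have hBcard : (B.card : ℝ) ≤ 4 * K * ε * N := by
    have h1 : (B.card : ℝ) * M ≤ ∑ v ∈ B, K * (y v + M) := by
      rw [← nsmul_eq_mul]
      exact Finset.card_nsmul_le_sum B _ M fun v hv => (Finset.mem_filter.1 hv).2.le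
    rw [← Finset.mul_sum] at h1
    have h2 : ∑ v ∈ B, (y v + M) ≤ ∑ v ∈ A, (y v + M) :=
      Finset.sum_le_sum_of_subset_of_nonneg (Finset.filter_subset _ _) fun v _ _ => hnn v
    have h3 : K * ∑ v ∈ B, (y v + M) ≤ K * (4 * ε * N * M) := by gcongr; linarith
    refine le_of_mul_le_mul_right ?_ hMpos
    linarith
  obtain ⟨p, hp, hpB⟩ := exists_disjoint_of_card_mul_lt
    (P := (A.powersetCard 2).filter fun p => ∃ e ∈ E, p ⊆ e) (B := B)
    (fun p hp => (Finset.mem_powersetCard.1 (Finset.mem_filter.1 hp).1).2) (by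
      have h1 := hpairs A (by
        rw [hAs]
        have : (1 / T + ε) * N = N / T + ε * N := by ring
        have : 0 < ε * N := by positivity
        linarith)
      have h2 : (B.card : ℝ) * N ≤ 4 * K * ε * N * N := by gcongr
      have h3 : 4 * K * ε < μ := by
        have h4 : ε * K ≤ ε * K ^ 3 := mul_le_mul_of_nonneg_left (hK2.trans hK3) hε.le
        have h5 : 0 < ε * K := by positivity
        linarith
      have h4 : 4 * K * ε * N * N < μ * N ^ 2 := by
        have := mul_lt_mul_of_pos_right h3 (by positivity : 0 < N ^ 2)
        linarith
      have h5 := (h2.trans_lt h4).trans_le h1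
      rw [hN] at h5
      exact_mod_cast h5)
  obtain ⟨hpA, hpE⟩ := Finset.mem_filter.1 hp
  obtain ⟨hpA, hpc⟩ := Finset.mem_powersetCard.1 hpA
  obtain ⟨u, v, huv, rfl⟩ := Finset.card_eq_two.1 hpc
  have hlow : ∀ x ∈ ({u, v} : Finset α), K * (y x + M) ≤ M := fun x hx => by
    by_contra! h
    exact Finset.disjoint_left.1 hpB hx (Finset.mem_filter.2 ⟨hpA hx, h⟩)
  have hu := hlow u (by simp)
  have hv := hlow v (by simp)
  have h1 := hedge {u, v} hpE u (by simp)
  rw [Finset.sum_pair huv, hpc] at h1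
  push_cast at h1
  have h2 : 0 ≤ (K - 1) * (K * y u) + (T - 1) * (K * y v) + (K - 2) * ((T - 1) * Y * K) := by
    have := mul_nonneg (by linarith : 0 ≤ K) h1
    linarith
  have h3 : (K - 1) * (K * y u) ≤ (K - 1) * (M - K * M) :=
    mul_le_mul_of_nonneg_left (by linarith) (by linarith)
  have h4 : (T - 1) * (K * y v) ≤ (T - 1) * (M - K * M) :=
    mul_le_mul_of_nonneg_left (by linarith) (by linarith)
  have h5 : (K - 2) * ((T - 1) * Y * K) ≤ (K - 2) * (M * (K + 1)) :=
    mul_le_mul_of_nonneg_left hYle (by linarith)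
  have h6 : 0 < M * ((K + T - 2) * (K - 1) - (K - 2) * (K + 1)) :=
    mul_pos hMpos (by nlinarith)
  linarith

/-- Non-extremal `k`-graphs (with `(k-ℓ) ∣ n`) have a `w*`-weighted perfect
fractional matching, where `w* = (k-1, t-1, …, t-1)`. -/
theorem weighted_perfect_fractional_matching
    (k l t : ℕ) (hk : 3 ≤ k) (hl : 1 ≤ l) (hlk : l ≤ k - 1)
    (ht : t = k / (k - l) * (k - l)) :
    ∃ μ₀ : ℝ, 0 < μ₀ ∧ ∀ μ : ℝ, 0 < μ → μ ≤ μ₀ →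
    ∃ ε₀ : ℝ, 0 < ε₀ ∧ ∀ ε : ℝ, 0 < ε → ε ≤ ε₀ →
    ∃ n₀ : ℕ, ∀ n : ℕ, n₀ ≤ n → (k - l) ∣ n →
    ∀ E : Finset (Finset (Fin n)),
      (∀ e ∈ E, e.card = k) →
      (∀ v : Fin n, ∃ e ∈ E, v ∈ e) →
      (∀ S : Finset (Fin n), S.card = k - 1 → (∃ e ∈ E, S ⊆ e) →
        (1 - 1 / (t : ℝ) - ε) * (n : ℝ) ≤ ((E.filter fun e => S ⊆ e).card : ℝ)) →
      (∀ A : Finset (Fin n), (n : ℝ) / (t : ℝ) ≤ (A.card : ℝ) →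
        μ * (n : ℝ) ^ 2 ≤
          (((A.powersetCard 2).filter fun p => ∃ e ∈ E, p ⊆ e).card : ℝ)) →
      ∃ q : (Fin k → Fin n) → ℝ,
        (∀ e ∈ orderedEdges k E, 0 ≤ q e) ∧
        ∀ v : Fin n,
          ∑ i : Fin k, ∑ e ∈ (orderedEdges k E).filter (fun e => e i = v),
            (if (i : ℕ) = 0 then (k : ℝ) - 1 else (t : ℝ) - 1) * q e = 1 := by
  classical
  have hkl : 0 < k - l := by omega
  have htk : t ≤ k := ht ▸ Nat.div_mul_le_self k (k - l)
  have ht2 : 2 ≤ t := by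
    have h1 : k < t + (k - l) := by
      have := Nat.div_add_mod k (k - l)
      have := Nat.mod_lt k hkl
      rw [ht, mul_comm]
      omega
    have h2 : k - l ≤ t := by
      rw [ht]
      exact Nat.le_mul_of_pos_left _ (Nat.div_pos (Nat.sub_le k l) hkl)
    omega
  have hkR : (3 : ℝ) ≤ k := by exact_mod_cast hk
  have htR : (2 : ℝ) ≤ t := by exact_mod_cast ht2
  refine ⟨1, one_pos, fun μ hμ hμ1 => ⟨μ / (8 * (k : ℝ) ^ 3), by positivity,
    fun ε hε hεμ => ⟨⌈1 / ε⌉₊, fun n hn _ E hE hiso hdeg hpairs => ?_⟩⟩⟩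
  rw [le_div_iff₀ (by positivity)] at hεμ
  have hnε : 1 ≤ ε * n := by
    have := (Nat.le_ceil (1 / ε)).trans (Nat.cast_le.2 hn)
    rwa [div_le_iff₀' hε] at this
  let w : Fin k → ℝ := fun i => if (i : ℕ) = 0 then (k : ℝ) - 1 else (t : ℝ) - 1
  have hpair : ∀ (o : Fin k → Fin n) (y : Fin n → ℝ),
      ∑ v, (∑ i, if o i = v then w i else 0) * y v = ∑ i, w i * y (o i) := fun o y => by
    simp_rw [Finset.sum_mul]
    rw [Finset.sum_comm]
    simp [ite_mul]
  have hinj : ∀ o ∈ orderedEdges k E, Function.Injective o := fun o ho =>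
    (Finset.mem_filter.1 ho).2.1
  obtain ⟨q, hq, hq1⟩ := exists_nonneg_combination_eq_one
    (fun (o : {o // o ∈ orderedEdges k E}) v => ∑ i, if o.1 i = v then w i else 0)
    (((k : ℝ) - 1) * t) (mul_pos (by linarith) (by linarith))
    (fun o => by
      have h1 := hpair o.1 (fun _ => 1)
      rw [show ∑ i, w i * 1 = _ from sum_weights_mul (by omega) _ _ _ (hinj _ o.2) (fun _ => 1), Finset.sum_const,
        Finset.card_image_of_injective _ (hinj _ o.2)] at h1
      simp only [mul_one, Finset.card_univ, Fintype.card_fin, nsmul_eq_mul] at h1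
      rw [h1]
      ring)
    (fun y hy => by
      refine sum_nonneg_of_edge_nonneg hk ht2 htk hμ1 hε hεμ (by simpa using hnε) hE hiso
        (by simpa using hdeg) (by simpa using hpairs) y fun e he u hu => ?_
      obtain ⟨o, ho, hou, hoe⟩ := exists_orderedEdge (by omega) hE he hu
      have h1 := hy ⟨o, ho⟩
      rw [hpair, sum_weights_mul (by omega) _ _ _ (hinj _ ho), hou, hoe] at h1
      linarith)
  refine ⟨fun o => if ho : o ∈ orderedEdges k E then q ⟨o, ho⟩ else 0,
    fun o ho => by simpa [ho] using hq ⟨o, ho⟩, fun v => ?_⟩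
  refine Eq.trans ?_ (hq1 v)
  simp_rw [Finset.sum_filter, Finset.mul_sum]
  rw [Finset.sum_comm, ← Finset.sum_coe_sort]
  refine Finset.sum_congr rfl fun o _ => Finset.sum_congr rfl fun i _ => ?_
  by_cases h : o.1 i = v
  · simp [h, w, mul_comm]
  · simp [h]
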